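/- arXiv:2506.17123 — 6 statements merged into one kernel-verified Lean document; each statement's English description precedes it below -/
import Mathlib

section
/- Let ℓ be an odd prime and let a be an integer not divisible by ℓ that is a square modulo ℓ (i.e., the image of a in ℤ/ℓℤ is a square). Let σ be a field automorphism of ℚ̄ lying in ℋ_ℓ. Then σ(x) = x for every x ∈ ℚ̄ with x² = a. -/
/-- `ℚ̄`: a fixed algebraic closure of `ℚ`. -/
noncomputable abbrev Qbar : Type := AlgebraicClosure ℚ

/-- A field automorphism `σ` of `ℚ̄` lies in `ℋ_ℓ` if there is an integer `e ≥ 0`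
such that `σ ζ = ζ ^ (ℓ ^ e)` for every root of unity `ζ` whose order is not
divisible by `ℓ` (equivalently, `ζ ^ n = 1` for some `n > 0` not divisible by `ℓ`). -/
def InHl (ℓ : ℕ) (σ : Qbar ≃+* Qbar) : Prop :=
  ∃ e : ℕ, ∀ (n : ℕ) (ζ : Qbar), 0 < n → ¬ ℓ ∣ n → ζ ^ n = 1 → σ ζ = ζ ^ ℓ ^ e

/-- The subring generated by the roots of unity of order not divisible by `ℓ`. -/
def primeToRootsSubring (ℓ : ℕ) (K : Type*) [Field K] : Subring K :=
  Subring.closure {ζ | ∃ n : ℕ, 0 < n ∧ ¬ ℓ ∣ n ∧ ζ ^ n = 1}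

section PrimeToRoots

variable {K : Type*} [Field K] {ℓ : ℕ}

lemma mem_primeToRootsSubring {n : ℕ} {ζ : K} (hn : 0 < n) (hdvd : ¬ ℓ ∣ n) (hζ : ζ ^ n = 1) :
    ζ ∈ primeToRootsSubring ℓ K :=
  Subring.subset_closure ⟨n, hn, hdvd, hζ⟩

lemma isIntegral_of_mem_primeToRootsSubring {y : K} (hy : y ∈ primeToRootsSubring ℓ K) :
    IsIntegral ℤ y := by
  refine (Subring.closure_le (t := (integralClosure ℤ K).toSubring)).2 ?_ hy
  rintro ζ ⟨n, hn, -, h⟩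
  exact IsIntegral.of_pow hn (h ▸ isIntegral_one)

/-- A ring endomorphism acting as `ζ ↦ ζ ^ ℓ ^ e` on roots of unity of order prime to `ℓ`
is congruent to `y ↦ y ^ ℓ ^ e` modulo `ℓ` on the ring they generate. -/
lemma exists_map_eq_pow_add_mul (hℓ : ℓ.Prime) (hodd : Odd ℓ) {e : ℕ} (σ : K →+* K)
    (hσ : ∀ (n : ℕ) (ζ : K), 0 < n → ¬ ℓ ∣ n → ζ ^ n = 1 → σ ζ = ζ ^ ℓ ^ e)
    {y : K} (hy : y ∈ primeToRootsSubring ℓ K) :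
    ∃ z ∈ primeToRootsSubring ℓ K, σ y = y ^ ℓ ^ e + ℓ * z := by
  induction hy using Subring.closure_induction with
  | mem ζ h =>
    obtain ⟨n, hn, hd, h1⟩ := h
    exact ⟨0, zero_mem _, by simpa using hσ n ζ hn hd h1⟩
  | zero => exact ⟨0, zero_mem _, by simp [hℓ.ne_zero]⟩
  | one => exact ⟨0, zero_mem _, by simp⟩
  | neg y _ ih =>
    obtain ⟨z, hz, h⟩ := ih
    exact ⟨-z, neg_mem hz, by rw [map_neg, h, hodd.pow.neg_pow]; ring⟩
  | add y y' hy hy' ih ih' =>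
    obtain ⟨z, hz, h⟩ := ih
    obtain ⟨z', hz', h'⟩ := ih'
    obtain ⟨r, hr⟩ := exists_add_pow_prime_pow_eq hℓ
      (⟨y, hy⟩ : primeToRootsSubring ℓ K) ⟨y', hy'⟩ e
    replace hr := congrArg Subtype.val hr
    push_cast at hr
    refine ⟨z + z' - y * y' * r, sub_mem (add_mem hz hz') (mul_mem (mul_mem hy hy') r.2), ?_⟩
    rw [map_add, h, h', hr]
    ring
  | mul y y' hy hy' ih ih' =>
    obtain ⟨z, hz, h⟩ := ih
    obtain ⟨z', hz', h'⟩ := ih'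
    refine ⟨y ^ ℓ ^ e * z' + z * y' ^ ℓ ^ e + ℓ * (z * z'), ?_, by rw [map_mul, h, h']; ring⟩
    exact add_mem (add_mem (mul_mem (pow_mem hy _) hz') (mul_mem hz (pow_mem hy' _)))
      (mul_mem (natCast_mem _ _) (mul_mem hz hz'))

variable [IsAlgClosed K]

lemma exists_mem_primeToRootsSubring_sq_eq_neg_one (hℓ : ℓ.Prime) (hodd : Odd ℓ) :
    ∃ i ∈ primeToRootsSubring ℓ K, i ^ 2 = -1 := by
  obtain ⟨i, hi⟩ := IsAlgClosed.exists_pow_nat_eq (-1 : K) (n := 2) two_pos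
  refine ⟨i, mem_primeToRootsSubring (n := 2 ^ 2) (by norm_num) ?_ ?_, hi⟩
  · exact (Nat.coprime_two_right.2 hodd).pow_right 2 |> (hℓ.coprime_iff_not_dvd).1
  · rw [show i ^ 2 ^ 2 = (i ^ 2) ^ 2 by ring, hi]; norm_num

lemma exists_mem_primeToRootsSubring_sq_eq_two (hℓ : ℓ.Prime) (hodd : Odd ℓ) :
    ∃ y ∈ primeToRootsSubring ℓ K, y ^ 2 = 2 := by
  obtain ⟨i, hi, hi2⟩ := exists_mem_primeToRootsSubring_sq_eq_neg_one (K := K) hℓ hodd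
  obtain ⟨w, hw⟩ := IsAlgClosed.exists_pow_nat_eq i (n := 2) two_pos
  have hwmem : w ∈ primeToRootsSubring ℓ K := by
    refine mem_primeToRootsSubring (n := 2 ^ 3) (by norm_num) ?_ ?_
    · exact (Nat.coprime_two_right.2 hodd).pow_right 3 |> (hℓ.coprime_iff_not_dvd).1
    · rw [show w ^ 2 ^ 3 = ((w ^ 2) ^ 2) ^ 2 by ring, hw, hi2]; norm_num
  refine ⟨(1 + i) * w ^ 7, mul_mem (add_mem (one_mem _) hi) (pow_mem hwmem 7), ?_⟩
  rw [show ((1 + i) * w ^ 7) ^ 2 = (1 + 2 * i + i ^ 2) * (w ^ 2) ^ 7 by ring, hw, hi2,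
    show (1 + 2 * i + -1) * i ^ 7 = 2 * (i ^ 2) ^ 4 by ring, hi2]
  norm_num

variable [CharZero K]

lemma exists_mem_primeToRootsSubring_sq_eq_prime (hℓ : ℓ.Prime) (hodd : Odd ℓ) {p : ℕ}
    (hp : p.Prime) (hpℓ : ¬ ℓ ∣ p) : ∃ y ∈ primeToRootsSubring ℓ K, y ^ 2 = p := by
  obtain rfl | hp2 := eq_or_ne p 2
  · exact_mod_cast exists_mem_primeToRootsSubring_sq_eq_two (K := K) hℓ hodd
  have := Fact.mk hp
  have : NeZero (p : K) := ⟨by exact_mod_cast hp.ne_zero⟩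
  obtain ⟨ζ, hζ⟩ := HasEnoughRootsOfUnity.exists_primitiveRoot K p
  have hζmem : ζ ∈ primeToRootsSubring ℓ K :=
    mem_primeToRootsSubring hp.pos hpℓ hζ.pow_eq_one
  have hchar : ringChar (ZMod p) ≠ 2 := by rwa [ZMod.ringChar_zmod_n]
  have hsq := gaussSum_sq
    ((MulChar.ringHomComp_ne_one_iff (RingHom.injective_int (Int.castRingHom K))).2
      (quadraticChar_ne_one hchar))
    ((quadraticChar_isQuadratic (ZMod p)).comp (Int.castRingHom K))
    (AddChar.zmodChar_primitive_of_primitive_root p hζ)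
  set g := gaussSum ((quadraticChar (ZMod p)).ringHomComp (Int.castRingHom K))
    (AddChar.zmodChar p ((IsPrimitiveRoot.iff_def ζ p).mp hζ).left)
  have hgmem : g ∈ primeToRootsSubring ℓ K :=
    sum_mem fun a _ ↦ mul_mem (by simp) (pow_mem hζmem _)
  rw [ZMod.card, MulChar.ringHomComp_apply] at hsq
  rcases quadraticChar_dichotomy (F := ZMod p) (a := -1) (by simp) with h | h
  · exact ⟨g, hgmem, by simpa [h] using hsq⟩
  · obtain ⟨i, hi, hi2⟩ := exists_mem_primeToRootsSubring_sq_eq_neg_one (K := K) hℓ hodd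
    exact ⟨i * g, mul_mem hi hgmem, by rw [mul_pow, hi2, hsq, h]; simp⟩

lemma exists_mem_primeToRootsSubring_sq_eq_natCast (hℓ : ℓ.Prime) (hodd : Odd ℓ) (n : ℕ)
    (hn : ¬ ℓ ∣ n) : ∃ y ∈ primeToRootsSubring ℓ K, y ^ 2 = n := by
  induction n using induction_on_primes with
  | zero => simp at hn
  | one => exact ⟨1, one_mem _, by simp⟩
  | prime_mul p n hp ih =>
    obtain ⟨y, hy, hyn⟩ := ih fun h ↦ hn (h.mul_left p)
    obtain ⟨z, hz, hzp⟩ := exists_mem_primeToRootsSubring_sq_eq_prime (K := K) hℓ hodd hp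
      fun h ↦ hn (h.mul_right n)
    exact ⟨z * y, mul_mem hz hy, by rw [mul_pow, hyn, hzp, Nat.cast_mul]⟩

lemma mem_primeToRootsSubring_of_sq_eq_intCast (hℓ : ℓ.Prime) (hodd : Odd ℓ) {a : ℤ}
    (ha : ¬ (ℓ : ℤ) ∣ a) {x : K} (hx : x ^ 2 = a) : x ∈ primeToRootsSubring ℓ K := by
  have hmem {y : K} (hy : y ∈ primeToRootsSubring ℓ K) (h : y ^ 2 = a) :
      x ∈ primeToRootsSubring ℓ K := by
    rcases sq_eq_sq_iff_eq_or_eq_neg.1 (hx.trans h.symm) with rfl | rfl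
    exacts [hy, neg_mem hy]
  obtain ⟨y, hy, hya⟩ := exists_mem_primeToRootsSubring_sq_eq_natCast (K := K) hℓ hodd a.natAbs
    (by rwa [← Int.natCast_dvd])
  rcases Int.natAbs_eq a with h | h
  · exact hmem hy (by rw [hya, h]; simp)
  · obtain ⟨i, hi, hi2⟩ := exists_mem_primeToRootsSubring_sq_eq_neg_one (K := K) hℓ hodd
    refine hmem (mul_mem hi hy) ?_
    rw [mul_pow, hi2, hya, h]
    simp

end PrimeToRoots

lemma Int.sq_dvd_of_sq_mul_eq {K : Type*} [Field K] [CharZero K] {m n : ℤ} {w : K}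
    (hm : m ≠ 0) (hw : IsIntegral ℤ w) (h : (n : K) = (m * w) ^ 2) : m ^ 2 ∣ n := by
  have hmK : (m : K) ≠ 0 := by exact_mod_cast hm
  have hq : algebraMap ℚ K (n / m ^ 2) = w ^ 2 := by
    rw [map_div₀, map_pow, map_intCast, map_intCast, h]
    field_simp
  have hint : IsIntegral ℤ (n / m ^ 2 : ℚ) :=
    (isIntegral_algebraMap_iff (algebraMap ℚ K).injective).1 (hq ▸ hw.pow 2)
  obtain ⟨c, hc⟩ := IsIntegrallyClosed.isIntegral_iff.1 hint
  have hmQ : (m : ℚ) ≠ 0 := by exact_mod_cast hm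
  refine ⟨c, ?_⟩
  rw [eq_intCast, eq_div_iff (pow_ne_zero 2 hmQ)] at hc
  rw [mul_comm]
  exact_mod_cast hc.symm

lemma ZMod.pow_half_eq_one_of_sq {ℓ : ℕ} [Fact ℓ.Prime] {b : ZMod ℓ} (hb : b ≠ 0) {e k : ℕ}
    (hk : ℓ ^ e = 2 * k + 1) : (b ^ 2) ^ k = 1 := by
  have h := ZMod.pow_card_pow (n := e) b
  rw [hk, pow_succ, pow_mul] at h
  exact mul_right_cancel₀ hb (by rw [h, one_mul])

theorem stmt0 (ℓ : ℕ) (hℓ : ℓ.Prime) (hodd : Odd ℓ) (a : ℤ)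
    (ha : ¬ (ℓ : ℤ) ∣ a) (hsq : ∃ b : ZMod ℓ, (a : ZMod ℓ) = b ^ 2)
    (σ : Qbar ≃+* Qbar) (hσ : InHl ℓ σ)
    (x : Qbar) (hx : x ^ 2 = (a : Qbar)) : σ x = x := by
  have := Fact.mk hℓ
  obtain ⟨e, he⟩ := hσ
  obtain ⟨b, hb⟩ := hsq
  have hb0 : b ≠ 0 := by
    rintro rfl
    exact ha ((ZMod.intCast_zmod_eq_zero_iff_dvd a ℓ).1 (by simpa using hb))
  have hxmem := mem_primeToRootsSubring_of_sq_eq_intCast hℓ hodd ha hx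
  obtain ⟨z, hz, hσx⟩ := exists_map_eq_pow_add_mul hℓ hodd (σ : Qbar →+* Qbar) he hxmem
  replace hσx : σ x = x ^ ℓ ^ e + ℓ * z := hσx
  obtain ⟨k, hk⟩ := hodd.pow (n := e)
  obtain ⟨m, hm⟩ : (ℓ : ℤ) ∣ a ^ k - 1 := by
    rw [← ZMod.intCast_zmod_eq_zero_iff_dvd]
    push_cast
    rw [hb, ZMod.pow_half_eq_one_of_sq hb0 hk, sub_self]
  have hak : (a : Qbar) ^ k = 1 + ℓ * m := by
    have : a ^ k = 1 + ℓ * m := by linarith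
    exact_mod_cast congrArg (Int.cast : ℤ → Qbar) this
  rw [hk, pow_succ, pow_mul, hx, hak] at hσx
  have hsq : σ x ^ 2 = x ^ 2 := by rw [← map_pow, hx, map_intCast]
  refine (sq_eq_sq_iff_eq_or_eq_neg.1 hsq).resolve_right fun hneg ↦ ha ?_
  have hw : IsIntegral ℤ (m * x + z) := isIntegral_of_mem_primeToRootsSubring
    (add_mem (mul_mem (intCast_mem _ m) hxmem) hz)
  have hdvd : (ℓ : ℤ) ^ 2 ∣ 2 ^ 2 * a := by
    refine Int.sq_dvd_of_sq_mul_eq (by exact_mod_cast hℓ.ne_zero) hw ?_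
    push_cast
    rw [← hx, show (ℓ : Qbar) * (m * x + z) = -(2 * x) by linear_combination hneg - hσx]
    ring
  refine IsCoprime.dvd_of_dvd_mul_left (x := (ℓ : ℤ)) (y := 2 ^ 2) ?_
    ((dvd_pow_self _ two_ne_zero).trans hdvd)
  exact_mod_cast Nat.isCoprime_iff_coprime.2 ((Nat.coprime_two_right.2 hodd).pow_right 2)
end

section
/- Let ℓ be an odd prime, let m be an odd positive integer, and let q be an integer not divisible by ℓ such that d_ℓ(q) = 2m. Let σ be a field automorphism of ℚ̄ lying in ℋ_ℓ. Then σ(x) = x for every x ∈ ℚ̄ with x² = −q. -/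
/-- The ring of algebraic integers contains primitive `n`-th roots of unity for every `n > 0`. -/
theorem exists_isPrimitiveRoot_integralClosure (n : ℕ) (hn : 0 < n) :
    ∃ ζ : integralClosure ℤ Qbar, IsPrimitiveRoot ζ n := by
  have : NeZero ((n : ℕ) : Qbar) := ⟨by exact_mod_cast hn.ne'⟩
  obtain ⟨z, hz⟩ := HasEnoughRootsOfUnity.exists_primitiveRoot Qbar n
  refine ⟨⟨z, hz.isIntegral hn⟩, ?_⟩
  exact IsPrimitiveRoot.of_map_of_injective (f := (integralClosure ℤ Qbar).val)
    (by exact hz) Subtype.val_injective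

/-- A prime number is not invertible in the ring of algebraic integers. -/
theorem natCast_mem_nonunits_integralClosure (p : ℕ) (hp : p.Prime) :
    (p : integralClosure ℤ Qbar) ∈ nonunits (integralClosure ℤ Qbar) := by
  intro h
  obtain ⟨b, hb⟩ := h.exists_right_inv
  have hb' : (p : Qbar) * (b : Qbar) = 1 := by
    have := congrArg (Subtype.val) hb
    simpa using this
  have hp0 : (p : ℚ) ≠ 0 := by exact_mod_cast hp.ne_zero
  have hbq : (b : Qbar) = algebraMap ℚ Qbar ((p : ℚ)⁻¹) := by
    rw [map_inv₀, map_natCast]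
    exact eq_inv_of_mul_eq_one_right hb'
  have hinv_int : IsIntegral ℤ ((p : ℚ)⁻¹) := by
    have h1 : IsIntegral ℤ (b : Qbar) := b.2
    rw [hbq] at h1
    exact (isIntegral_algebraMap_iff (algebraMap ℚ Qbar).injective).1 h1
  obtain ⟨z, hz⟩ := IsIntegrallyClosed.isIntegral_iff.1 hinv_int
  have hz' : (p : ℚ) * (z : ℚ) = 1 := by
    have hz2 : (z : ℚ) = (p : ℚ)⁻¹ := by simpa using hz
    rw [hz2, mul_inv_cancel₀ hp0]
  have h2 : (p : ℤ) * z = 1 := by exact_mod_cast hz'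
  have h3 : IsUnit (p : ℤ) := IsUnit.of_mul_eq_one _ h2
  exact (Nat.prime_iff_prime_int.1 hp).not_isUnit h3

/-- A subring of the ring of algebraic integers containing all roots of unity of order prime to
`ℓ` contains a square root of every odd prime `p ≠ ℓ`. -/
theorem exists_sq_eq_odd_prime (ℓ : ℕ) (S : Subring (integralClosure ℤ Qbar))
    (hS : ∀ (n : ℕ) (ζ : integralClosure ℤ Qbar), 0 < n → ¬ ℓ ∣ n → ζ ^ n = 1 → ζ ∈ S)
    (i : integralClosure ℤ Qbar) (hi : i ∈ S) (hi2 : i ^ 2 = -1)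
    (p : ℕ) (hp : p.Prime) (hp2 : p ≠ 2) (hpl : ¬ ℓ ∣ p) :
    ∃ s ∈ S, s ^ 2 = (p : integralClosure ℤ Qbar) := by
  have : Fact p.Prime := ⟨hp⟩
  obtain ⟨ζ, hζ⟩ := exists_isPrimitiveRoot_integralClosure p hp.pos
  have hψ := AddChar.zmodChar_primitive_of_primitive_root p hζ
  set ψ := AddChar.zmodChar p ((IsPrimitiveRoot.iff_def ζ p).1 hζ).1
  set χ : MulChar (ZMod p) (integralClosure ℤ Qbar) :=
    (quadraticChar (ZMod p)).ringHomComp (Int.castRingHom _) with hχdef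
  have hinj : Function.Injective (Int.castRingHom (integralClosure ℤ Qbar)) :=
    Int.cast_injective
  have hχ1 : χ ≠ 1 := by
    rw [hχdef, MulChar.ringHomComp_ne_one_iff hinj]
    exact quadraticChar_ne_one (by simpa [ZMod.ringChar_zmod_n] using hp2)
  have hχq : χ.IsQuadratic := (quadraticChar_isQuadratic (ZMod p)).comp _
  have hsq := gaussSum_sq hχ1 hχq hψ
  rw [ZMod.card] at hsq
  have hg : gaussSum χ ψ ∈ S := by
    refine S.sum_mem fun a _ => S.mul_mem ?_ ?_
    · rcases hχq a with h | h | h <;> rw [h]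
      · exact S.zero_mem
      · exact S.one_mem
      · exact S.neg_mem S.one_mem
    · refine hS p _ hp.pos hpl ?_
      rw [← AddChar.map_nsmul_eq_pow, nsmul_eq_mul, ZMod.natCast_self, zero_mul,
        AddChar.map_zero_eq_one]
  rcases hχq (-1) with h | h | h
  · rw [h, zero_mul] at hsq
    have h0 : χ (-1) * χ (-1) = 1 := by rw [← map_mul]; simp
    rw [h] at h0
    simp at h0
  · exact ⟨_, hg, by rw [hsq, h, one_mul]⟩
  · exact ⟨_, S.mul_mem hi hg, by rw [mul_pow, hsq, h, hi2]; ring⟩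

/-- A subring of the ring of algebraic integers containing all roots of unity of order prime to
an odd prime `ℓ` contains all square roots of the integers not divisible by `ℓ`. -/
theorem mem_of_sq_eq_intCast (ℓ : ℕ) (hℓ : ℓ.Prime) (hodd : Odd ℓ)
    (S : Subring (integralClosure ℤ Qbar))
    (hS : ∀ (n : ℕ) (ζ : integralClosure ℤ Qbar), 0 < n → ¬ ℓ ∣ n → ζ ^ n = 1 → ζ ∈ S)
    (d : ℤ) (hd : ¬ (ℓ : ℤ) ∣ d) (x : integralClosure ℤ Qbar)
    (hx : x ^ 2 = (d : integralClosure ℤ Qbar)) : x ∈ S := by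
  have hl2 : ¬ ℓ ∣ 2 := fun h => by
    rw [(Nat.prime_dvd_prime_iff_eq hℓ Nat.prime_two).1 h] at hodd
    exact absurd hodd (by decide)
  have hl8 : ¬ ℓ ∣ 8 := fun h => hl2 (hℓ.dvd_of_dvd_pow (show ℓ ∣ 2 ^ 3 from h))
  obtain ⟨ω, hω⟩ := exists_isPrimitiveRoot_integralClosure 8 (by norm_num)
  have hω8 := hω.pow_eq_one
  have hωS : ω ∈ S := hS 8 ω (by norm_num) hl8 hω8
  have hω4 : ω ^ 4 = -1 := by
    have h1 : (ω ^ 4 - 1) * (ω ^ 4 + 1) = 0 := by linear_combination hω8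
    rcases mul_eq_zero.1 h1 with h | h
    · exact absurd (sub_eq_zero.1 h) (hω.pow_ne_one_of_pos_of_lt (by norm_num) (by norm_num))
    · linear_combination h
  have hi : ω ^ 2 ∈ S := S.pow_mem hωS 2
  have hi2 : (ω ^ 2) ^ 2 = -1 := by rw [← pow_mul, hω4]
  have hnat : ∀ n : ℕ, ¬ ℓ ∣ n → ∃ s ∈ S, s ^ 2 = (n : integralClosure ℤ Qbar) := by
    intro n
    induction n using Nat.recOnMul with
    | zero => intro h; exact absurd (dvd_zero _) h
    | one => intro _; exact ⟨1, S.one_mem, by simp⟩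
    | prime p hp =>
      intro h
      rcases eq_or_ne p 2 with rfl | hp2
      · refine ⟨ω - ω ^ 3, S.sub_mem hωS (S.pow_mem hωS 3), ?_⟩
        push_cast
        linear_combination (ω ^ 2 - 2) * hω4
      · exact exists_sq_eq_odd_prime ℓ S hS _ hi hi2 p hp hp2 h
    | mul a b ha hb =>
      intro h
      obtain ⟨s, hs, hs2⟩ := ha fun h' => h (h'.mul_right b)
      obtain ⟨t, ht, ht2⟩ := hb fun h' => h (h'.mul_left a)
      exact ⟨s * t, S.mul_mem hs ht, by rw [mul_pow, hs2, ht2]; push_cast; rfl⟩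
  have hsqrt : ∃ s ∈ S, s ^ 2 = (d : integralClosure ℤ Qbar) := by
    obtain ⟨s, hs, hs2⟩ := hnat d.natAbs (fun h => hd (Int.natCast_dvd.2 h))
    rcases Int.natAbs_eq d with h | h
    · exact ⟨s, hs, by rw [hs2, h]; simp⟩
    · refine ⟨ω ^ 2 * s, S.mul_mem hi hs, ?_⟩
      rw [mul_pow, hi2, hs2, h]; simp
  obtain ⟨s, hs, hs2⟩ := hsqrt
  rcases sq_eq_sq_iff_eq_or_eq_neg.1 (hx.trans hs2.symm) with rfl | rfl
  · exact hs
  · exact S.neg_mem hs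

/-- If `q` has order `2 * m` modulo `ℓ` with `m` odd, then `-q` satisfies Euler's criterion. -/
theorem neg_pow_half_eq_one (ℓ : ℕ) (hℓ : ℓ.Prime) (hodd : Odd ℓ) (m : ℕ) (hm : Odd m)
    (a : ZMod ℓ) (hord : orderOf a = 2 * m) : (-a) ^ (ℓ / 2) = 1 := by
  have : Fact ℓ.Prime := ⟨hℓ⟩
  have hmpos := hm.pos
  have ha : a ≠ 0 := by
    rintro rfl
    have := pow_orderOf_eq_one (0 : ZMod ℓ)
    rw [hord, zero_pow (by omega)] at this
    exact zero_ne_one this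
  have h1 : a ^ m = -1 := by
    have h2 : a ^ m * a ^ m = 1 := by
      rw [← pow_add, ← two_mul, ← hord, pow_orderOf_eq_one]
    rcases mul_self_eq_one_iff.1 h2 with h | h
    · have := Nat.le_of_dvd hmpos (orderOf_dvd_of_pow_eq_one h)
      omega
    · exact h
  have hdvd : 2 * m ∣ ℓ - 1 := hord ▸ ZMod.orderOf_dvd_card_sub_one ha
  obtain ⟨k, hk⟩ := hdvd
  have hℓ2 : ℓ / 2 = m * k := by
    obtain ⟨t, ht⟩ := hodd
    have : 2 * (m * k) = 2 * t := by rw [← mul_assoc]; omega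
    omega
  rw [hℓ2, pow_mul, hm.neg_pow, h1, neg_neg, one_pow]

theorem stmt3 (ℓ : ℕ) (hℓ : ℓ.Prime) (hodd : Odd ℓ) (m : ℕ) (hm : Odd m)
    (hmpos : 0 < m) (q : ℤ) (hq : ¬ (ℓ : ℤ) ∣ q)
    (hord : orderOf ((q : ZMod ℓ)) = 2 * m)
    (σ : Qbar ≃+* Qbar) (hσ : InHl ℓ σ)
    (x : Qbar) (hx : x ^ 2 = -(q : Qbar)) : σ x = x := by
  have : Fact ℓ.Prime := ⟨hℓ⟩
  obtain ⟨e, he⟩ := hσ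
  let I : Ideal (integralClosure ℤ Qbar) := Ideal.span {(ℓ : integralClosure ℤ Qbar)}
  have : CharP (integralClosure ℤ Qbar ⧸ I) ℓ :=
    CharP.quotient _ ℓ (natCast_mem_nonunits_integralClosure ℓ hℓ)
  let τ : integralClosure ℤ Qbar →+* integralClosure ℤ Qbar :=
    (AlgHom.mapIntegralClosure (σ : Qbar →+* Qbar).toIntAlgHom).toRingHom
  have hτ (a : integralClosure ℤ Qbar) : ((τ a : integralClosure ℤ Qbar) : Qbar) = σ a := rfl
  let π := Ideal.Quotient.mk I
  let S : Subring (integralClosure ℤ Qbar) :=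
    RingHom.eqLocus (π.comp τ) ((iterateFrobenius _ ℓ e).comp π)
  have hS : ∀ (n : ℕ) (ζ : integralClosure ℤ Qbar), 0 < n → ¬ ℓ ∣ n → ζ ^ n = 1 → ζ ∈ S := by
    intro n ζ hn hln hζ
    have h1 : τ ζ = ζ ^ ℓ ^ e := by
      apply Subtype.ext
      rw [hτ, he n ζ hn hln (by simpa using congrArg Subtype.val hζ)]
      simp
    change π (τ ζ) = iterateFrobenius _ ℓ e (π ζ)
    rw [h1, map_pow, iterateFrobenius_def]
  have hxint : IsIntegral ℤ x := by
    refine IsIntegral.of_pow (n := 2) (by norm_num) ?_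
    rw [hx]
    exact (isIntegral_algebraMap (R := ℤ) (x := q)).neg
  let y : integralClosure ℤ Qbar := ⟨x, hxint⟩
  have hy : y ^ 2 = ((-q : ℤ) : integralClosure ℤ Qbar) := by
    apply Subtype.ext
    simpa [y] using hx
  have hyS : y ∈ S := mem_of_sq_eq_intCast ℓ hℓ hodd S hS (-q) (by rwa [dvd_neg]) y hy
  have hyS' : π (τ y) = (π y) ^ ℓ ^ e := hyS
  have hπ2 : (π y) ^ 2 = ((-q : ℤ) : integralClosure ℤ Qbar ⧸ I) := by
    rw [← map_pow, hy, map_intCast]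
  have hfrob : (π y) ^ ℓ = π y := by
    have h1 := congrArg (ZMod.castHom dvd_rfl (integralClosure ℤ Qbar ⧸ I))
      (neg_pow_half_eq_one ℓ hℓ hodd m hm _ hord)
    have h2 : (((-q : ℤ) : integralClosure ℤ Qbar ⧸ I)) ^ (ℓ / 2) = 1 := by
      simpa only [map_pow, map_neg, map_intCast, map_one, Int.cast_neg] using h1
    have h3 : ℓ = 2 * (ℓ / 2) + 1 := by have := Nat.odd_iff.1 hodd; omega
    calc (π y) ^ ℓ = (π y) ^ (2 * (ℓ / 2) + 1) := by rw [← h3]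
      _ = π y := by rw [pow_succ, pow_mul, hπ2, h2, one_mul]
  have hiter (k : ℕ) : (π y) ^ ℓ ^ k = π y := by
    induction k with
    | zero => simp
    | succ k ih => rw [pow_succ, pow_mul, ih, hfrob]
  rw [hiter e] at hyS'
  have hsq : (σ x) ^ 2 = x ^ 2 := by rw [← map_pow, hx]; simp
  rcases sq_eq_sq_iff_eq_or_eq_neg.1 hsq with h | h
  · exact h
  · exfalso
    have hneg : τ y = -y := Subtype.ext (by rw [hτ]; simpa [y] using h)
    rw [hneg, map_neg] at hyS'
    have h4 : ((4 * (-q) : ℤ) : integralClosure ℤ Qbar ⧸ I) = 0 := by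
      rw [Int.cast_mul, ← hπ2]
      push_cast
      linear_combination (-2 * π y) * hyS'
    rw [CharP.intCast_eq_zero_iff _ ℓ] at h4
    rcases (Nat.prime_iff_prime_int.1 hℓ).dvd_mul.1 h4 with h5 | h5
    · have h6 : ℓ ∣ 2 ^ 2 := by exact_mod_cast h5
      have h7 := (Nat.prime_dvd_prime_iff_eq hℓ Nat.prime_two).1 (hℓ.dvd_of_dvd_pow h6)
      rw [h7] at hodd
      exact absurd hodd (by decide)
    · exact hq ((dvd_neg).1 h5)
end

section
/- Let ℓ be an odd prime and let q be a prime power not divisible by ℓ such that d_ℓ(q) is odd. Let σ be a field automorphism of ℚ̄ lying in ℋ_ℓ. Then σ(x) = x for every x ∈ ℚ̄ with x² = q. -/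
/-- Elements `z` integral over `ℤ` with `σ z ≡ z ^ ℓ ^ e` modulo `ℓ`. -/
def frobeniusCongr (ℓ e : ℕ) (hℓ : ℓ.Prime) (σ : Qbar ≃+* Qbar) : Subsemiring Qbar where
  carrier := {z | IsIntegral ℤ z ∧ ∃ r, IsIntegral ℤ r ∧ σ z = z ^ ℓ ^ e + ℓ * r}
  one_mem' := ⟨isIntegral_one, 0, isIntegral_zero, by simp⟩
  zero_mem' := ⟨isIntegral_zero, 0, isIntegral_zero, by simp [hℓ.ne_zero]⟩
  mul_mem' := by
    rintro a b ⟨ha, r, hr, hra⟩ ⟨hb, s, hs, hsb⟩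
    refine ⟨ha.mul hb, a ^ ℓ ^ e * s + b ^ ℓ ^ e * r + ℓ * (r * s), ?_, ?_⟩
    · exact (((ha.pow _).mul hs).add ((hb.pow _).mul hr)).add
        (.mul (isIntegral_natCast ℓ) (hr.mul hs))
    · rw [map_mul, hra, hsb]; ring
  add_mem' := by
    rintro a b ⟨ha, r, hr, hra⟩ ⟨hb, s, hs, hsb⟩
    obtain ⟨t, ht⟩ := exists_add_pow_prime_pow_eq hℓ
      (⟨a, ha⟩ : integralClosure ℤ Qbar) ⟨b, hb⟩ e
    have ht' := congrArg (algebraMap (integralClosure ℤ Qbar) Qbar) ht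
    simp only [map_add, map_pow, map_mul, map_natCast] at ht'
    change (a + b) ^ ℓ ^ e = a ^ ℓ ^ e + b ^ ℓ ^ e + ℓ * a * b * (t : Qbar) at ht'
    refine ⟨ha.add hb, r + s - a * b * t, (hr.add hs).sub ((ha.mul hb).mul t.2), ?_⟩
    rw [map_add, hra, hsb, ht']; ring

theorem mem_frobeniusCongr_of_pow_eq_one {ℓ e : ℕ} (hℓ : ℓ.Prime) {σ : Qbar ≃+* Qbar}
    (hσ : ∀ (n : ℕ) (ζ : Qbar), 0 < n → ¬ ℓ ∣ n → ζ ^ n = 1 → σ ζ = ζ ^ ℓ ^ e)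
    {n : ℕ} {ζ : Qbar} (hn : 0 < n) (hℓn : ¬ ℓ ∣ n) (hζ : ζ ^ n = 1) :
    ζ ∈ frobeniusCongr ℓ e hℓ σ :=
  ⟨.of_pow hn (hζ ▸ isIntegral_one), 0, isIntegral_zero, by simp [hσ n ζ hn hℓn hζ]⟩

/-- A square root of a prime `p` lies in every subsemiring containing the `p`-th and `8`-th roots of
unity. -/
theorem mem_of_sq_eq_prime {p : ℕ} (hp : p.Prime) {S : Subsemiring Qbar}
    (hS : ∀ ζ : Qbar, ζ ^ p = 1 ∨ ζ ^ 8 = 1 → ζ ∈ S)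
    {y : Qbar} (hy : y ^ 2 = p) : y ∈ S := by
  have hneg : (-1 : Qbar) ∈ S := hS _ (.inr (by norm_num))
  suffices ∃ z ∈ S, z ^ 2 = (p : Qbar) by
    obtain ⟨z, hz, hzp⟩ := this
    rcases sq_eq_sq_iff_eq_or_eq_neg.mp (hy.trans hzp.symm) with rfl | rfl
    · exact hz
    · simpa using S.mul_mem hneg hz
  obtain ⟨i, hi⟩ := IsAlgClosed.exists_pow_nat_eq (-1 : Qbar) two_pos
  have hiS : i ∈ S := hS i (.inr (by rw [show 8 = 2 * 4 from rfl, pow_mul, hi]; norm_num))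
  rcases hp.eq_two_or_odd' with rfl | hodd
  · obtain ⟨w, hw⟩ := IsAlgClosed.exists_pow_nat_eq i two_pos
    have hwS : w ∈ S := hS w (.inr (by
      rw [show 8 = 2 * (2 * 2) from rfl, pow_mul, hw, pow_mul, hi]; norm_num))
    refine ⟨w + w ^ 7, S.add_mem hwS (S.pow_mem hwS 7), ?_⟩
    have h4 : w ^ 4 = -1 := by rw [show 4 = 2 * 2 from rfl, pow_mul, hw, hi]
    push_cast
    linear_combination (2 * w ^ 4 - 2 + w ^ 10 - w ^ 6 + w ^ 2) * h4
  · have := Fact.mk hp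
    have hp2 : ringChar (ZMod p) ≠ 2 := by
      rw [ZMod.ringChar_zmod_n]; rintro rfl; exact absurd hodd (by decide)
    obtain ⟨ζ, hζ⟩ := HasEnoughRootsOfUnity.prim (M := Qbar) (n := p)
    let χ : MulChar (ZMod p) Qbar := (quadraticChar (ZMod p)).ringHomComp (Int.castRingHom Qbar)
    have hχ : χ ≠ 1 := by
      obtain ⟨a, ha⟩ := quadraticChar_exists_neg_one' hp2
      intro h
      have := congrArg (fun f : MulChar (ZMod p) Qbar => f a) h
      simp only [χ, MulChar.ringHomComp_apply, ha, MulChar.one_apply_coe] at this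
      norm_num at this
    have hχ2 : χ.IsQuadratic := (quadraticChar_isQuadratic (ZMod p)).comp _
    have hχS (a : ZMod p) : χ a ∈ S := by
      rcases hχ2 a with h | h | h <;> rw [h]
      exacts [S.zero_mem, S.one_mem, hneg]
    have hg := gaussSum_sq hχ hχ2 (AddChar.zmodChar_primitive_of_primitive_root p hζ)
    set ψ := AddChar.zmodChar p hζ.pow_eq_one
    have hgS : gaussSum χ ψ ∈ S := S.sum_mem fun a _ => S.mul_mem (hχS a) <| hS _ <| .inl <| by
      rw [AddChar.zmodChar_apply, ← pow_mul, mul_comm, pow_mul, hζ.pow_eq_one, one_pow]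
    rw [ZMod.card] at hg
    rcases hχ2 (-1) with h | h | h <;> rw [h] at hg
    · exact absurd h (isUnit_one.neg.map χ).ne_zero
    · exact ⟨_, hgS, by simpa using hg⟩
    · exact ⟨_, S.mul_mem hiS hgS, by rw [mul_pow, hi, hg]; ring⟩

/-- An element of odd order in `ZMod ℓ` is a square, so raising a square root of it to the power
`ℓ ^ e` changes it only by a multiple of `ℓ`. -/
theorem exists_pow_prime_pow_eq_of_odd_orderOf {ℓ q : ℕ} (hℓ : ℓ.Prime) (hodd : Odd ℓ)
    (hord : Odd (orderOf (q : ZMod ℓ))) (e : ℕ) {x : Qbar} (hx : x ^ 2 = q) :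
    ∃ m : ℤ, x ^ ℓ ^ e = x + ℓ * (m * x) := by
  have := Fact.mk hℓ
  obtain ⟨d, hd⟩ := hord
  obtain ⟨k, hk⟩ := hodd.pow (n := e)
  have hq : ((q : ZMod ℓ) ^ (d + 1)) ^ 2 = q := by
    rw [← pow_mul, show (d + 1) * 2 = orderOf (q : ZMod ℓ) + 1 by omega, pow_succ,
      pow_orderOf_eq_one, one_mul]
  have hq0 : (q : ZMod ℓ) ≠ 0 := by
    intro h
    have := pow_orderOf_eq_one (q : ZMod ℓ)
    rw [h, zero_pow (by rw [← h]; omega)] at this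
    exact zero_ne_one this
  have hqk : (q : ZMod ℓ) ^ k = 1 := by
    apply mul_left_cancel₀ (pow_ne_zero (d + 1) hq0)
    nth_rewrite 2 [← hq]
    rw [← pow_mul, ← pow_succ', ← hk, ZMod.pow_card_pow, mul_one]
  obtain ⟨m, hm⟩ : (ℓ : ℤ) ∣ (q : ℤ) ^ k - 1 := by
    rw [← ZMod.intCast_zmod_eq_zero_iff_dvd]
    push_cast
    rw [hqk, sub_self]
  have hm' : (q : Qbar) ^ k - 1 = ℓ * m := by exact_mod_cast congrArg (Int.cast : ℤ → Qbar) hm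
  refine ⟨m, ?_⟩
  rw [hk, pow_succ, pow_mul, hx]
  linear_combination x * hm'

/-- If `2x` is divisible by `ℓ` as an algebraic integer and `x ^ 2 = q`, then `ℓ` divides `q`. -/
theorem dvd_of_two_mul_eq {ℓ q : ℕ} (hℓ : ℓ.Prime) (hodd : Odd ℓ) {x r : Qbar}
    (hx : x ^ 2 = q) (hr : IsIntegral ℤ r) (h : 2 * x = ℓ * r) : ℓ ∣ q := by
  have hℓ0 : (ℓ : ℚ) ≠ 0 := by exact_mod_cast hℓ.ne_zero
  have hℓ0' : (ℓ : Qbar) ≠ 0 := by exact_mod_cast hℓ.ne_zero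
  have hr2 : algebraMap ℚ Qbar (4 * q / ℓ ^ 2) = r ^ 2 := by
    simp only [map_div₀, map_mul, map_pow, map_natCast, map_ofNat]
    rw [div_eq_iff (pow_ne_zero 2 hℓ0')]
    linear_combination (-4) * hx + (2 * x + ℓ * r) * h
  have hint : IsIntegral ℤ (4 * q / ℓ ^ 2 : ℚ) :=
    (isIntegral_algebraMap_iff (algebraMap ℚ Qbar).injective).mp (hr2 ▸ hr.pow 2)
  obtain ⟨m, hm⟩ := IsIntegrallyClosed.isIntegral_iff.mp hint
  rw [eq_div_iff (pow_ne_zero 2 hℓ0)] at hm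
  have hm' : m * (ℓ : ℤ) ^ 2 = ((4 * q : ℕ) : ℤ) := by
    have : ((m * (ℓ : ℤ) ^ 2 : ℤ) : ℚ) = (((4 * q : ℕ) : ℤ) : ℚ) := by
      push_cast; simpa using hm
    exact_mod_cast this
  have hdvd : ℓ ∣ 4 * q := by
    rw [← Int.natCast_dvd_natCast, ← hm']
    exact Dvd.intro_left (m * ℓ) (by ring)
  refine (hℓ.dvd_mul.mp hdvd).resolve_left fun h4 => ?_
  have h2 : ℓ ∣ 2 := hℓ.dvd_of_dvd_pow (n := 2) h4
  rw [(Nat.prime_dvd_prime_iff_eq hℓ Nat.prime_two).mp h2] at hodd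
  exact absurd hodd (by decide)

theorem stmt4 (ℓ : ℕ) (hℓ : ℓ.Prime) (hodd : Odd ℓ) (q : ℕ)
    (hq : ∃ p k : ℕ, p.Prime ∧ 1 ≤ k ∧ q = p ^ k) (hℓq : ¬ ℓ ∣ q)
    (hord : Odd (orderOf ((q : ZMod ℓ))))
    (σ : Qbar ≃+* Qbar) (hσ : InHl ℓ σ)
    (x : Qbar) (hx : x ^ 2 = (q : Qbar)) : σ x = x := by
  obtain ⟨e, he⟩ := hσ
  obtain ⟨p, k, hp, hk, hqpk⟩ := hq
  have hℓp : ¬ ℓ ∣ p := fun h => hℓq (hqpk ▸ dvd_pow h (by omega))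
  have hℓ8 : ¬ ℓ ∣ 8 := fun h => by
    have h2 : ℓ ∣ 2 := hℓ.dvd_of_dvd_pow (n := 3) h
    rw [(Nat.prime_dvd_prime_iff_eq hℓ Nat.prime_two).mp h2] at hodd
    exact absurd hodd (by decide)
  have hS (ζ : Qbar) : ζ ^ p = 1 ∨ ζ ^ 8 = 1 → ζ ∈ frobeniusCongr ℓ e hℓ σ := by
    rintro (h | h)
    · exact mem_frobeniusCongr_of_pow_eq_one hℓ he hp.pos hℓp h
    · exact mem_frobeniusCongr_of_pow_eq_one hℓ he (by norm_num) hℓ8 h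
  obtain ⟨y, hy⟩ := IsAlgClosed.exists_pow_nat_eq (p : Qbar) two_pos
  have hyS := mem_of_sq_eq_prime hp hS hy
  have hxy : x ^ 2 = (y ^ k) ^ 2 := by rw [hx, ← pow_mul, mul_comm, pow_mul, hy, hqpk]; simp
  have hxS : x ∈ frobeniusCongr ℓ e hℓ σ := by
    rcases sq_eq_sq_iff_eq_or_eq_neg.mp hxy with h | h <;> rw [h]
    · exact pow_mem hyS k
    · rw [← neg_one_mul]
      exact mul_mem (hS _ (.inr (by norm_num))) (pow_mem hyS k)
  obtain ⟨hxi, r, hr, hσx⟩ := hxS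
  obtain ⟨m, hm⟩ := exists_pow_prime_pow_eq_of_odd_orderOf hℓ hodd hord e hx
  have hsq : σ x ^ 2 = x ^ 2 := by rw [← map_pow, hx, map_natCast]
  refine (sq_eq_sq_iff_eq_or_eq_neg.mp hsq).resolve_right fun h => hℓq ?_
  refine dvd_of_two_mul_eq hℓ hodd hx (r := -(m * x + r)) ?_ ?_
  · exact (((isIntegral_algebraMap (R := ℤ) (x := m)).mul hxi).add hr).neg
  · linear_combination h - hσx - hm
end

section
/- Let ℓ be an odd prime, let p₀ be a power of a prime with ℓ not dividing p₀, let r be a positive integer, set q = p₀^r, and let d be the multiplicative order of q modulo ℓ. Let a be a positive divisor of d and let ζ ∈ ℚ_ℓ be a primitive a-th root of unity (such ζ exists in ℚ_ℓ since a divides ℓ − 1). Then the polynomial X^r − ζ has a root in ℚ_ℓ, i.e., there exists x ∈ ℚ_ℓ with x^r = ζ. -/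
/-- The order of a residue class modulo `ℓ` is the order of a root of unity in `ℤ_[ℓ]`. -/
theorem PadicInt.exists_isPrimitiveRoot_orderOf (ℓ : ℕ) [Fact ℓ.Prime] (b : ℕ) (hb : ¬ ℓ ∣ b) :
    ∃ z : ℤ_[ℓ], IsPrimitiveRoot z (orderOf (b : ZMod ℓ)) := by
  have hb0 : (b : ZMod ℓ) ≠ 0 := by rwa [Ne, ZMod.natCast_eq_zero_iff]
  have hdvd : orderOf (b : ZMod ℓ) ∣ ℓ - 1 := ZMod.orderOf_dvd_card_sub_one hb0
  have hprime : ℓ.Prime := Fact.out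
  have hl : 0 < ℓ - 1 := by have := hprime.two_le; omega
  have hpos := Nat.pos_of_dvd_of_pos hdvd hl
  have hlt : orderOf (b : ZMod ℓ) < ℓ := by have := Nat.le_of_dvd hl hdvd; omega
  have hpow := pow_orderOf_eq_one (b : ZMod ℓ)
  generalize hN : orderOf (b : ZMod ℓ) = N at *
  have norm_lt_one_iff (x : ℤ_[ℓ]) : ‖x‖ < 1 ↔ PadicInt.toZMod x = 0 := by
    rw [← RingHom.mem_ker, PadicInt.ker_toZMod, IsLocalRing.mem_maximalIdeal,
      PadicInt.mem_nonunits]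
  have norm_eq_one (x : ℤ_[ℓ]) (hx : PadicInt.toZMod x ≠ 0) : ‖x‖ = 1 := by
    refine le_antisymm (PadicInt.norm_le_one x) (not_lt.1 ?_)
    rwa [norm_lt_one_iff]
  have hN0 : (N : ZMod ℓ) ≠ 0 := by
    rw [Ne, ZMod.natCast_eq_zero_iff]
    exact Nat.not_dvd_of_pos_of_lt hpos hlt
  have hder : ‖(Polynomial.X ^ N - 1 : Polynomial ℤ_[ℓ]).derivative.aeval (b : ℤ_[ℓ])‖ = 1 := by
    apply norm_eq_one
    simp [Polynomial.derivative_X_pow, hN0, hb0]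
  obtain ⟨z, hz, hzb, -⟩ := hensels_lemma (R := ℤ_[ℓ])
    (F := (Polynomial.X ^ N - 1 : Polynomial ℤ_[ℓ]))
    (a := (b : ℤ_[ℓ])) (by
      rw [hder, one_pow, norm_lt_one_iff]
      simp [hpow])
  rw [hder, norm_lt_one_iff] at hzb
  have hzb' : PadicInt.toZMod z = b := by simpa [sub_eq_zero] using hzb
  refine ⟨z, by simpa [sub_eq_zero] using hz, fun k hk => ?_⟩
  rw [← hN]
  apply orderOf_dvd_of_pow_eq_one
  rw [← hzb', ← map_pow, hk, map_one]

theorem stmt7 (ℓ : ℕ) [Fact ℓ.Prime] (hodd : Odd ℓ)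
    (p₀ : ℕ) (hp₀ : ∃ p k : ℕ, p.Prime ∧ 1 ≤ k ∧ p₀ = p ^ k) (hℓp₀ : ¬ ℓ ∣ p₀)
    (r : ℕ) (hr : 0 < r) (q : ℕ) (hqdef : q = p₀ ^ r)
    (d : ℕ) (hd : d = orderOf ((q : ZMod ℓ)))
    (a : ℕ) (ha : 0 < a) (had : a ∣ d)
    (ζ : ℚ_[ℓ]) (hζ : IsPrimitiveRoot ζ a) :
    ∃ x : ℚ_[ℓ], x ^ r = ζ := by
  obtain ⟨z, hz⟩ := PadicInt.exists_isPrimitiveRoot_orderOf ℓ p₀ hℓp₀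
  have hω : IsPrimitiveRoot (z : ℚ_[ℓ]) (orderOf (p₀ : ZMod ℓ)) :=
    hz.map_of_injective (f := PadicInt.Coe.ringHom) Subtype.coe_injective
  generalize (z : ℚ_[ℓ]) = ω at hω
  have hd' : d = orderOf (ω ^ r) := by
    rw [hd, hqdef, Nat.cast_pow, orderOf_pow' _ hr.ne', orderOf_pow' _ hr.ne', hω.eq_orderOf]
  have hroot : IsPrimitiveRoot (ω ^ r) d := hd' ▸ IsPrimitiveRoot.orderOf (ω ^ r)
  have : NeZero d := ⟨by
    have h0 : (q : ZMod ℓ) ≠ 0 := by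
      rw [hqdef, Nat.cast_pow]
      exact pow_ne_zero _ (by rwa [Ne, ZMod.natCast_eq_zero_iff])
    have hdvd : d ∣ ℓ - 1 := hd ▸ ZMod.orderOf_dvd_card_sub_one h0
    exact (Nat.pos_of_dvd_of_pos hdvd (Nat.sub_pos_of_lt (Fact.out : ℓ.Prime).one_lt)).ne'⟩
  obtain ⟨i, -, hi⟩ := hroot.eq_pow_of_pow_eq_one ((hζ.pow_eq_one_iff_dvd d).2 had)
  exact ⟨ω ^ i, by rw [← hi, pow_right_comm]⟩
end

section
/- Let ℓ be an odd prime, let p₀ be a power of a prime with ℓ not dividing p₀, let r be a positive integer, let q be a positive integer with q² = p₀^r, and let ε ∈ {1, −1}. Let d′ be the multiplicative order of εq modulo ℓ. If the polynomial X^r − εq has no root in ℚ_ℓ (i.e., there is no x ∈ ℚ_ℓ with x^r = εq), then d′ is even. -/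
/-- The map `x ↦ x ^ n` is a bijection on the principal units of `ℤ_[p]` when `p ∤ n`. -/
theorem PadicInt.existsUnique_pow_eq_of_toZMod_eq_one {p : ℕ} [Fact p.Prime] {n : ℕ}
    (hn : ¬ p ∣ n) {z : ℤ_[p]} (hz : PadicInt.toZMod z = 1) :
    ∃! t : ℤ_[p], t ^ n = z ∧ PadicInt.toZMod t = 1 := by
  have norm_sub_one (t : ℤ_[p]) : ‖t - 1‖ < 1 ↔ PadicInt.toZMod t = 1 := by
    rw [← PadicInt.mem_nonunits, ← IsLocalRing.mem_maximalIdeal, ← PadicInt.ker_toZMod,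
      RingHom.mem_ker, map_sub, map_one, sub_eq_zero]
  have hnorm : ‖(n : ℤ_[p])‖ = 1 := by
    refine le_antisymm (PadicInt.norm_le_one _) (not_lt.mp fun h ↦ hn ?_)
    rw [← PadicInt.mem_nonunits, ← IsLocalRing.mem_maximalIdeal, ← PadicInt.ker_toZMod,
      RingHom.mem_ker, map_natCast] at h
    exact (ZMod.natCast_eq_zero_iff n p).mp h
  let F : Polynomial ℤ_[p] := Polynomial.X ^ n - Polynomial.C z
  have hF (t : ℤ_[p]) : F.aeval t = 0 ↔ t ^ n = z := by simp [F, sub_eq_zero]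
  have hF' : ‖F.derivative.aeval (1 : ℤ_[p])‖ = 1 := by
    simp [F, Polynomial.derivative_X_pow, hnorm]
  have h1 : ‖F.aeval (1 : ℤ_[p])‖ < ‖F.derivative.aeval (1 : ℤ_[p])‖ ^ 2 := by
    rw [hF', one_pow]
    simpa [F, norm_sub_rev] using (norm_sub_one z).mpr hz
  obtain ⟨t, ht, ht1, -, huniq⟩ := hensels_lemma h1
  rw [hF'] at ht1 huniq
  exact ⟨t, ⟨(hF t).mp ht, (norm_sub_one t).mp ht1⟩,
    fun s hs ↦ huniq s ((hF s).mpr hs.1) ((norm_sub_one s).mpr hs.2)⟩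

theorem stmt8 (ℓ : ℕ) [Fact ℓ.Prime] (hodd : Odd ℓ)
    (p₀ : ℕ) (hp₀ : ∃ p k : ℕ, p.Prime ∧ 1 ≤ k ∧ p₀ = p ^ k) (hℓp₀ : ¬ ℓ ∣ p₀)
    (r : ℕ) (hr : 0 < r) (q : ℕ) (hq : 0 < q) (hq2 : (q : ℤ) ^ 2 = (p₀ : ℤ) ^ r)
    (ε : ℤ) (hε : ε = 1 ∨ ε = -1)
    (d' : ℕ) (hd' : d' = orderOf (((ε * q : ℤ) : ZMod ℓ)))
    (hnoroot : ¬ ∃ x : ℚ_[ℓ], x ^ r = ((ε * q : ℤ) : ℚ_[ℓ])) :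
    Even d' := by
  by_contra hd
  obtain ⟨k, hk⟩ := Nat.not_even_iff_odd.mp hd
  have hℓ : ℓ.Prime := Fact.out
  set u : ℤ := ε * q with hu
  have hu2 : u ^ 2 = (p₀ : ℤ) ^ r := by
    rw [← hq2, hu, mul_pow]
    rcases hε with rfl | rfl <;> simp
  have hu2' : (u : ℤ_[ℓ]) ^ 2 = (p₀ : ℤ_[ℓ]) ^ r := by
    exact_mod_cast congrArg (Int.cast : ℤ → ℤ_[ℓ]) hu2
  have hv : PadicInt.toZMod ((u : ℤ_[ℓ]) ^ d') = 1 := by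
    rw [map_pow, map_intCast, hd', pow_orderOf_eq_one]
  have hz : PadicInt.toZMod ((p₀ : ℤ_[ℓ]) ^ (d' * (ℓ - 1))) = 1 := by
    rw [map_pow, map_natCast, mul_comm, pow_mul, ZMod.pow_card_sub_one_eq_one, one_pow]
    rwa [Ne, ZMod.natCast_eq_zero_iff]
  have hn : ¬ ℓ ∣ 2 * (ℓ - 1) := by
    rw [hℓ.dvd_mul, not_or]
    refine ⟨fun h ↦ ?_, Nat.not_dvd_of_pos_of_lt (by have := hℓ.two_le; omega)
      (by have := hℓ.two_le; omega)⟩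
    rw [(Nat.prime_dvd_prime_iff_eq hℓ Nat.prime_two).mp h] at hodd
    exact absurd hodd (by decide)
  obtain ⟨t, ⟨ht, ht1⟩, -⟩ := PadicInt.existsUnique_pow_eq_of_toZMod_eq_one hn hz
  have hvt : (u : ℤ_[ℓ]) ^ d' = t ^ r := by
    refine (PadicInt.existsUnique_pow_eq_of_toZMod_eq_one hn
      (z := (t ^ r) ^ (2 * (ℓ - 1))) (by simp [ht1])).unique ⟨?_, hv⟩ ⟨rfl, by simp [ht1]⟩
    calc ((u : ℤ_[ℓ]) ^ d') ^ (2 * (ℓ - 1)) = ((u : ℤ_[ℓ]) ^ 2) ^ (d' * (ℓ - 1)) := by ring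
      _ = ((p₀ : ℤ_[ℓ]) ^ (d' * (ℓ - 1))) ^ r := by rw [hu2']; ring
      _ = (t ^ r) ^ (2 * (ℓ - 1)) := by rw [← ht]; ring
  have ht0 : t ≠ 0 := by
    rintro rfl
    simp at ht1
  have hut : (u : ℤ_[ℓ]) * t ^ r = ((p₀ : ℤ_[ℓ]) ^ (k + 1)) ^ r := by
    calc (u : ℤ_[ℓ]) * t ^ r = ((u : ℤ_[ℓ]) ^ 2) ^ (k + 1) := by rw [← hvt, hk]; ring
      _ = ((p₀ : ℤ_[ℓ]) ^ (k + 1)) ^ r := by rw [hu2']; ring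
  have ht0' : (t : ℚ_[ℓ]) ≠ 0 := fun h ↦ ht0 (PadicInt.coe_eq_zero.mp h)
  refine hnoroot ⟨(p₀ : ℚ_[ℓ]) ^ (k + 1) / t, ?_⟩
  rw [div_pow, div_eq_iff (pow_ne_zero _ ht0')]
  exact_mod_cast (congrArg (fun x : ℤ_[ℓ] ↦ (x : ℚ_[ℓ])) hut).symm
end

section
/- Let d be an even positive integer, let B be a finite set of natural numbers, and let b ∈ B with b ≥ d and b − d ∉ B. Then the β-set (B \ {b}) ∪ {b − d} obtained from B by removing a single d-hook can also be obtained from B by a finite sequence of 2-hook removals; that is, B and (B \ {b}) ∪ {b − d} are related under the reflexive–transitive closure of the 2-hook removal relation on finite sets of natural numbers. -/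
/-- A single `d`-hook removal on a β-set (finite set of natural numbers) `B`:
replace `B` by `(B \ {b}) ∪ {b - d}` for some `b ∈ B` with `b ≥ d` and `b - d ∉ B`. -/
def HookStep (d : ℕ) (B B' : Finset ℕ) : Prop :=
  ∃ b ∈ B, d ≤ b ∧ b - d ∉ B ∧ B' = insert (b - d) (B.erase b)

/-- Moving the bead `a + 2 * (k + 1)` to the vacant position `a` is a composition of
`2`-hook removals. -/
theorem HookStep.reflTransGen_two_of_add (k a : ℕ) (B : Finset ℕ) (hb : a + 2 * (k + 1) ∈ B)
    (ha : a ∉ B) :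
    Relation.ReflTransGen (HookStep 2) B (insert a (B.erase (a + 2 * (k + 1)))) := by
  induction k generalizing B with
  | zero => exact .single ⟨a + 2, hb, by omega, by simpa using ha, by simp⟩
  | succ k ih =>
    have hsub : a + 2 * (k + 1 + 1) - 2 = a + 2 * (k + 1) := by omega
    by_cases h : a + 2 * (k + 1) ∈ B
    · refine (ih B h ha).tail ⟨a + 2 * (k + 1 + 1), ?_, by omega, ?_, ?_⟩
      · simp [hb]
      · simp [hsub]
      · ext x
        simp only [hsub, Finset.mem_insert, Finset.mem_erase]
        grind
    · refine .head (b := insert (a + 2 * (k + 1)) (B.erase (a + 2 * (k + 1 + 1))))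
        ⟨_, hb, by omega, by rwa [hsub], by rw [hsub]⟩ ?_
      convert ih (insert (a + 2 * (k + 1)) (B.erase (a + 2 * (k + 1 + 1)))) (Finset.mem_insert_self _ _) (by simp [ha]) using 1
      ext x
      simp only [Finset.mem_insert, Finset.mem_erase]
      grind

theorem stmt9 (d : ℕ) (hd : Even d) (hdpos : 0 < d) (B : Finset ℕ)
    (b : ℕ) (hb : b ∈ B) (hbd : d ≤ b) (hnot : b - d ∉ B) :
    Relation.ReflTransGen (HookStep 2) B (insert (b - d) (B.erase b)) := by
  obtain ⟨m, rfl⟩ := hd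
  obtain ⟨k, rfl⟩ : ∃ k, m = k + 1 := ⟨m - 1, by omega⟩
  have hb' : b - (k + 1 + (k + 1)) + 2 * (k + 1) = b := by omega
  have := HookStep.reflTransGen_two_of_add k (b - (k + 1 + (k + 1))) B (by rwa [hb']) hnot
  rwa [hb'] at this
end
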